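/- arXiv:math/0702682 — 4 statements merged into one kernel-verified Lean document; each statement's English description precedes it below -/
import Mathlib

section
/- Let X ~ N(θ, 1/n) with n > 0 and τ ≥ 1, μ₀ = E_{θ=0}[(X² − τ/n)_+], and ξ̂ = (X² − τ/n)_+ − μ₀. Then Var(ξ̂) ≤ 6θ²/n + (4τ^{1/2} + 18)/(n² e^{τ/2}). -/
open MeasureTheory ProbabilityTheory
open scoped NNReal

theorem integrable_gaussianReal_iff (μ : ℝ) {v : ℝ≥0} (hv : v ≠ 0) (f : ℝ → ℝ) :
    Integrable f (gaussianReal μ v) ↔ Integrable (fun x => gaussianPDFReal μ v x * f x) := by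
  rw [gaussianReal_of_var_ne_zero μ hv,
    integrable_withDensity_iff_integrable_smul' (measurable_gaussianPDF μ v)
      (ae_of_all _ fun _ => gaussianPDF_lt_top)]
  simp

theorem integrable_pow_gaussianReal (μ : ℝ) (v : ℝ≥0) (k : ℕ) :
    Integrable (fun x => x ^ k) (gaussianReal μ v) :=
  integrable_pow_of_mem_interior_integrableExpSet (X := id) (by simp) k

theorem hasDerivAt_gaussianPDFReal_one (a x : ℝ) :
    HasDerivAt (gaussianPDFReal a 1) (-(x - a) * gaussianPDFReal a 1 x) x := by
  have h : HasDerivAt (fun y : ℝ => -(y - a) ^ 2 / (2 * ((1 : ℝ≥0) : ℝ))) (-(x - a)) x := by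
    have := ((((hasDerivAt_id x).sub_const a).pow 2).neg).div_const (2 * ((1 : ℝ≥0) : ℝ))
    refine this.congr_deriv ?_
    simp
    ring
  refine (h.exp.const_mul (√(2 * Real.pi * (1 : ℝ≥0)))⁻¹).congr_deriv ?_
  rw [gaussianPDFReal]
  ring

/-- Stein recursion for the moments of a unit-variance Gaussian. -/
theorem integral_pow_add_two_gaussianReal_one (a : ℝ) (k : ℕ) :
    ∫ x, x ^ (k + 2) ∂(gaussianReal a 1) =
      a * ∫ x, x ^ (k + 1) ∂(gaussianReal a 1) + (k + 1) * ∫ x, x ^ k ∂(gaussianReal a 1) := by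
  have hI (j : ℕ) : Integrable (fun x => gaussianPDFReal a 1 x * x ^ j) :=
    (integrable_gaussianReal_iff a one_ne_zero _).1 (integrable_pow_gaussianReal a 1 j)
  have hd (x : ℝ) : HasDerivAt (fun x => gaussianPDFReal a 1 x * x ^ (k + 1))
      (a * (gaussianPDFReal a 1 x * x ^ (k + 1)) + (k + 1) * (gaussianPDFReal a 1 x * x ^ k)
        - gaussianPDFReal a 1 x * x ^ (k + 2)) x := by
    refine ((hasDerivAt_gaussianPDFReal_one a x).mul (hasDerivAt_pow (k + 1) x)).congr_deriv ?_
    push_cast [Nat.add_sub_cancel]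
    ring
  have h0 := integral_eq_zero_of_hasDerivAt_of_integrable hd
    ((((hI (k + 1)).const_mul a).add ((hI k).const_mul (k + 1))).sub (hI (k + 2))) (hI (k + 1))
  rw [integral_sub (by exact ((hI (k + 1)).const_mul a).add ((hI k).const_mul (k + 1)))
      (hI (k + 2)), integral_add ((hI (k + 1)).const_mul a) ((hI k).const_mul (k + 1)),
    integral_const_mul, integral_const_mul] at h0
  simp only [integral_gaussianReal_eq_integral_smul one_ne_zero, smul_eq_mul]
  linarith

theorem integral_sq_gaussianReal_one (a : ℝ) :
    ∫ x, x ^ 2 ∂(gaussianReal a 1) = a ^ 2 + 1 := by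
  rw [integral_pow_add_two_gaussianReal_one a 0]
  simp
  ring

theorem integral_pow_four_gaussianReal_one (a : ℝ) :
    ∫ x, x ^ 4 ∂(gaussianReal a 1) = a ^ 4 + 6 * a ^ 2 + 3 := by
  rw [integral_pow_add_two_gaussianReal_one a 2, integral_pow_add_two_gaussianReal_one a 1,
    integral_sq_gaussianReal_one]
  simp
  ring

theorem integral_pow_six_gaussianReal_one :
    ∫ x, x ^ 6 ∂(gaussianReal 1 1) = 76 := by
  rw [integral_pow_add_two_gaussianReal_one 1 4, integral_pow_add_two_gaussianReal_one 1 3,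
    integral_pow_add_two_gaussianReal_one 1 1, integral_pow_four_gaussianReal_one,
    integral_sq_gaussianReal_one]
  simp
  norm_num

theorem memLp_sq_gaussianReal (a : ℝ) (v : ℝ≥0) :
    MemLp (fun x => x ^ 2) 2 (gaussianReal a v) := by
  rw [memLp_two_iff_integrable_sq (by fun_prop)]
  simpa only [← pow_mul] using integrable_pow_gaussianReal a v 4

theorem variance_sq_gaussianReal_one (a : ℝ) :
    variance (fun x => x ^ 2) (gaussianReal a 1) = 4 * a ^ 2 + 2 := by
  rw [variance_eq_sub (memLp_sq_gaussianReal a 1)]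
  simp only [Pi.pow_apply, ← pow_mul]
  rw [integral_pow_four_gaussianReal_one, integral_sq_gaussianReal_one]
  ring

theorem MeasureTheory.MemLp.max_sub_const_zero {Ω : Type*} {m : MeasurableSpace Ω} {μ : Measure Ω}
    [IsFiniteMeasure μ] {f : Ω → ℝ} (hf : MemLp f 2 μ) (t : ℝ) :
    MemLp (fun x => max (f x - t) 0) 2 μ := by
  refine (hf.sub (memLp_const t)).mono
    ((hf.aestronglyMeasurable.sub aestronglyMeasurable_const).sup aestronglyMeasurable_const)
    (ae_of_all _ fun x => ?_)
  simp only [Real.norm_eq_abs, Pi.sub_apply]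
  rw [abs_of_nonneg (le_max_right _ _)]
  exact max_le (le_abs_self _) (abs_nonneg _)

theorem variance_max_sub_const_zero_le {Ω : Type*} {m : MeasurableSpace Ω} {μ : Measure Ω}
    [IsProbabilityMeasure μ] {f : Ω → ℝ} (hf : MemLp f 2 μ) (t : ℝ) :
    variance (fun x => max (f x - t) 0) μ ≤ variance f μ := by
  have hg := hf.max_sub_const_zero t
  set c := max (∫ x, f x ∂μ - t) 0
  rw [← variance_sub_const hg.aestronglyMeasurable c]
  refine (variance_le_expectation_sq
    (hg.aestronglyMeasurable.sub aestronglyMeasurable_const)).trans ?_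
  rw [variance_eq_integral hf.aestronglyMeasurable.aemeasurable]
  refine integral_mono (hg.sub (memLp_const c)).integrable_sq
    (hf.sub (memLp_const _)).integrable_sq fun x => ?_
  simp only [Pi.pow_apply]
  rw [sq_le_sq]
  refine (abs_max_sub_max_le_abs _ _ _).trans_eq ?_
  congr 1
  ring

theorem cosh_mul_le {a : ℝ} (ha : a ^ 2 ≤ 1) (x : ℝ) :
    Real.cosh (a * x) ≤ 1 - a ^ 2 + a ^ 2 * Real.cosh x := by
  have h1 := (hasSum_ite_eq 0 (1 - a ^ 2)).add ((Real.hasSum_cosh x).mul_left (a ^ 2))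
  refine hasSum_le (fun n => ?_) (Real.hasSum_cosh (a * x)) h1
  rcases n with _ | n
  · simp
  · have hx : 0 ≤ x ^ (2 * (n + 1)) / ((2 * (n + 1)).factorial : ℝ) :=
      div_nonneg (by rw [pow_mul]; positivity) (by positivity)
    have hp : a ^ (2 * (n + 1)) ≤ a ^ 2 := by
      rw [pow_mul, pow_succ]
      exact mul_le_of_le_one_left (sq_nonneg a) (pow_le_one₀ (sq_nonneg a) ha)
    simp only [Nat.add_eq_zero_iff, one_ne_zero, and_false, if_false, zero_add, mul_pow,
      mul_div_assoc]
    exact mul_le_mul_of_nonneg_right hp hx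

theorem gaussianPDFReal_one_add_neg (a x : ℝ) :
    gaussianPDFReal a 1 x + gaussianPDFReal (-a) 1 x =
      2 * Real.exp (-(a ^ 2 / 2)) * Real.cosh (a * x) * gaussianPDFReal 0 1 x := by
  have h (b : ℝ) : gaussianPDFReal b 1 x =
      Real.exp (-(b ^ 2 / 2)) * Real.exp (b * x) * gaussianPDFReal 0 1 x := by
    simp only [gaussianPDFReal, NNReal.coe_one]
    rw [mul_left_comm, ← Real.exp_add, ← Real.exp_add]
    congr 2
    ring
  rw [h a, h (-a), Real.cosh_eq, neg_sq, neg_mul]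
  ring

theorem gaussianPDFReal_one_add_neg_le {a : ℝ} (ha : a ^ 2 ≤ 1) (x : ℝ) :
    gaussianPDFReal a 1 x + gaussianPDFReal (-a) 1 x ≤
      (1 - a ^ 2) * (2 * gaussianPDFReal 0 1 x) +
        a ^ 2 * Real.exp (1 / 2) * (gaussianPDFReal 1 1 x + gaussianPDFReal (-1) 1 x) := by
  have h0 := gaussianPDFReal_nonneg 0 1 x
  have hexp : Real.exp (-(a ^ 2 / 2)) ≤ 1 := Real.exp_le_one_iff.2 (by nlinarith [sq_nonneg a])
  have he : Real.exp (1 / 2) * Real.exp (-(1 ^ 2 / 2)) = 1 := by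
    rw [← Real.exp_add]; norm_num
  have hc : Real.exp (-(a ^ 2 / 2)) * Real.cosh (a * x) ≤ 1 - a ^ 2 + a ^ 2 * Real.cosh x :=
    (mul_le_of_le_one_left (Real.cosh_pos _).le hexp).trans (cosh_mul_le ha x)
  rw [gaussianPDFReal_one_add_neg a, gaussianPDFReal_one_add_neg 1, one_mul]
  calc _ = 2 * gaussianPDFReal 0 1 x * (Real.exp (-(a ^ 2 / 2)) * Real.cosh (a * x)) := by ring
    _ ≤ 2 * gaussianPDFReal 0 1 x * (1 - a ^ 2 + a ^ 2 * Real.cosh x) := by gcongr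
    _ = 2 * gaussianPDFReal 0 1 x * (1 - a ^ 2 +
          a ^ 2 * (Real.exp (1 / 2) * Real.exp (-(1 ^ 2 / 2))) * Real.cosh x) := by
        rw [he, mul_one]
    _ = _ := by ring

theorem two_mul_integral_gaussianReal_one_of_even {g : ℝ → ℝ} (heven : ∀ x, g (-x) = g x)
    {a : ℝ} (hgi : ∀ b, Integrable g (gaussianReal b 1)) :
    2 * ∫ x, g x ∂(gaussianReal a 1) =
      ∫ x, (gaussianPDFReal a 1 x + gaussianPDFReal (-a) 1 x) * g x := by
  have hI (b : ℝ) := (integrable_gaussianReal_iff b one_ne_zero g).1 (hgi b)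
  have hneg : ∫ x, g x ∂(gaussianReal (-a) 1) = ∫ x, g x ∂(gaussianReal a 1) := by
    rw [← gaussianReal_map_neg, integral_map (by fun_prop)
      (gaussianReal_map_neg (μ := a) (v := 1) ▸ (hgi (-a)).aestronglyMeasurable)]
    simp only [heven]
  simp only [add_mul]
  rw [integral_add (hI a) (hI (-a)), two_mul]
  nth_rewrite 2 [← hneg]
  simp only [integral_gaussianReal_eq_integral_smul one_ne_zero, smul_eq_mul]

/-- For `a ^ 2 ≤ 1`, the expectation of an even nonnegative function under `N(a, 1)` is bounded by
interpolating in `a ^ 2` between its values at `0` and at `1`. -/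
theorem integral_gaussianReal_one_le_of_even {g : ℝ → ℝ} (heven : ∀ x, g (-x) = g x)
    (hg : ∀ x, 0 ≤ g x) (hgi : ∀ b, Integrable g (gaussianReal b 1)) {a : ℝ} (ha : a ^ 2 ≤ 1) :
    ∫ x, g x ∂(gaussianReal a 1) ≤ (1 - a ^ 2) * ∫ x, g x ∂(gaussianReal 0 1) +
      a ^ 2 * Real.exp (1 / 2) * ∫ x, g x ∂(gaussianReal 1 1) := by
  have hI (b : ℝ) : Integrable fun x =>
      (gaussianPDFReal b 1 x + gaussianPDFReal (-b) 1 x) * g x := by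
    simp only [add_mul]
    exact ((integrable_gaussianReal_iff b one_ne_zero g).1 (hgi b)).add
      ((integrable_gaussianReal_iff (-b) one_ne_zero g).1 (hgi (-b)))
  have key := integral_mono (hI a)
    (((hI 0).const_mul (1 - a ^ 2)).add ((hI 1).const_mul (a ^ 2 * Real.exp (1 / 2))))
    (fun x => by
      have := mul_le_mul_of_nonneg_right (gaussianPDFReal_one_add_neg_le ha x) (hg x)
      simp only [Pi.add_apply, neg_zero]
      linarith)
  rw [integral_add' ((hI 0).const_mul _) ((hI 1).const_mul _), integral_const_mul,
    integral_const_mul] at key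
  simp only [← two_mul_integral_gaussianReal_one_of_even heven hgi] at key
  linarith

theorem sq_max_zero_le_exp {s : ℝ} (hs : 0 < s) (u : ℝ) :
    (max u 0) ^ 2 ≤ (2 / s) ^ 2 * Real.exp (-2) * Real.exp (s * u) := by
  have h : max u 0 ≤ 2 / s * Real.exp (s * u / 2 - 1) := by
    refine max_le ?_ (by positivity)
    calc u = 2 / s * (s * u / 2 - 1 + 1) := by field_simp; ring
      _ ≤ _ := by gcongr; exact Real.add_one_le_exp _
  calc (max u 0) ^ 2 ≤ (2 / s * Real.exp (s * u / 2 - 1)) ^ 2 := by gcongr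
    _ = (2 / s) ^ 2 * Real.exp (-2) * Real.exp (s * u) := by
      rw [mul_pow, ← Real.exp_nat_mul, mul_assoc, ← Real.exp_add]
      congr 2
      push_cast
      ring

theorem integrable_sq_max_sq_sub_gaussianReal (τ a : ℝ) (v : ℝ≥0) :
    Integrable (fun x => (max (x ^ 2 - τ) 0) ^ 2) (gaussianReal a v) :=
  ((memLp_sq_gaussianReal a v).max_sub_const_zero τ).integrable_sq

theorem integral_sq_max_sq_sub_gaussianReal_zero_one_le {τ : ℝ} (hτ : 1 < τ) :
    ∫ x, (max (x ^ 2 - τ) 0) ^ 2 ∂(gaussianReal 0 1) ≤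
      16 * Real.exp (-(3 / 2)) / (1 - 1 / τ) ^ 2 * √τ * Real.exp (-(τ / 2)) := by
  have hτ0 : 0 < τ := by linarith
  have hs : 0 < 1 - 1 / τ := by
    rw [sub_pos, div_lt_one hτ0]; exact hτ
  set K := 16 * Real.exp (-(3 / 2)) / (1 - 1 / τ) ^ 2 * Real.exp (-(τ / 2)) *
    (√(2 * Real.pi))⁻¹ with hK
  have hb : 0 < 1 / (2 * τ) := by positivity
  have hpt (x : ℝ) : gaussianPDFReal 0 1 x * (max (x ^ 2 - τ) 0) ^ 2 ≤
      K * Real.exp (-(1 / (2 * τ)) * x ^ 2) := by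
    refine (mul_le_mul_of_nonneg_left (sq_max_zero_le_exp (half_pos hs) (x ^ 2 - τ))
      (gaussianPDFReal_nonneg 0 1 x)).trans_eq ?_
    have he : Real.exp (-x ^ 2 / 2) * Real.exp (-2) * Real.exp ((1 - 1 / τ) / 2 * (x ^ 2 - τ)) =
        Real.exp (-(3 / 2)) * Real.exp (-(τ / 2)) * Real.exp (-(1 / (2 * τ)) * x ^ 2) := by
      simp only [← Real.exp_add]
      congr 1
      field_simp
      ring
    simp only [gaussianPDFReal, NNReal.coe_one, mul_one, sub_zero]
    calc _ = 16 / (1 - 1 / τ) ^ 2 * (√(2 * Real.pi))⁻¹ * (Real.exp (-x ^ 2 / 2) * Real.exp (-2) *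
          Real.exp ((1 - 1 / τ) / 2 * (x ^ 2 - τ))) := by
          field_simp
          ring
      _ = _ := by rw [he, hK]; ring
  rw [integral_gaussianReal_eq_integral_smul one_ne_zero]
  simp only [smul_eq_mul]
  refine (integral_mono ((integrable_gaussianReal_iff 0 one_ne_zero _).1
    (integrable_sq_max_sq_sub_gaussianReal τ 0 1))
    ((integrable_exp_neg_mul_sq hb).const_mul K) hpt).trans_eq ?_
  have hsqrt : √(Real.pi / (1 / (2 * τ))) = √(2 * Real.pi) * √τ := by
    rw [← Real.sqrt_mul (by positivity)]
    congr 1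
    field_simp
  have hpi : √(2 * Real.pi) ≠ 0 := by positivity
  rw [integral_const_mul, integral_gaussian, hsqrt, hK]
  field_simp

theorem exp_neg_three_halves_le : Real.exp (-(3 / 2)) ≤ 0.2233 := by
  have h : Real.exp (3 / 2) ^ 2 = Real.exp 1 ^ 3 := by
    rw [← Real.exp_nat_mul, ← Real.exp_nat_mul]; norm_num
  have h1 : (2.718 : ℝ) ^ 3 ≤ Real.exp 1 ^ 3 := by
    gcongr
    linarith [Real.exp_one_gt_d9]
  have h2 : (4.48 : ℝ) ≤ Real.exp (3 / 2) := by
    refine le_of_sq_le_sq ?_ (Real.exp_pos _).le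
    rw [h]
    exact le_trans (by norm_num) h1
  rw [Real.exp_neg]
  exact (inv_anti₀ (by norm_num) h2).trans (by norm_num)

theorem integral_sq_max_sq_sub_gaussianReal_zero_one_le_mul_exp {τ : ℝ} (hτ : 9 / 2 ≤ τ) :
    ∫ x, (max (x ^ 2 - τ) 0) ^ 2 ∂(gaussianReal 0 1) ≤
      (4 * √τ + 18) * Real.exp (-(τ / 2)) := by
  refine (integral_sq_max_sq_sub_gaussianReal_zero_one_le (by linarith)).trans ?_
  gcongr
  have hτ0 : 0 < τ := by linarith
  have hr : 1 ≤ √τ := Real.one_le_sqrt.2 (by linarith)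
  have hr2 : √τ ^ 2 = τ := Real.sq_sqrt hτ0.le
  have hs : 0 < 1 - 1 / τ := by
    rw [sub_pos, div_lt_one hτ0]; linarith
  have h1 : 1 / (1 - 1 / τ) ^ 2 ≤ 1 + 3 / τ := by
    rw [div_le_iff₀ (by positivity)]
    have hx : 1 / τ ≤ 2 / 9 := by rw [div_le_div_iff₀ hτ0 (by norm_num)]; linarith
    have hx0 : 0 < 1 / τ := by positivity
    have h3 : 3 / τ = 3 * (1 / τ) := by ring
    rw [h3]
    generalize 1 / τ = y at *
    nlinarith [mul_nonneg hx0.le (sub_nonneg.2 hx), mul_nonneg hx0.le (sq_nonneg y)]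
  calc 16 * Real.exp (-(3 / 2)) / (1 - 1 / τ) ^ 2 * √τ
      = 16 * Real.exp (-(3 / 2)) * (1 / (1 - 1 / τ) ^ 2) * √τ := by ring
    _ ≤ 16 * 0.2233 * (1 + 3 / τ) * √τ := by
      gcongr
      exact exp_neg_three_halves_le
    _ = 16 * 0.2233 * (√τ + 3 / √τ) := by
      conv_lhs => rw [← hr2]
      rw [Real.sqrt_sq (by positivity)]
      field_simp
    _ ≤ 4 * √τ + 18 := by
      have : 3 / √τ ≤ 3 := div_le_self (by norm_num) hr
      linarith

theorem exp_half_mul_integral_sq_max_sq_sub_gaussianReal_one_one_le {τ : ℝ} (hτ : 9 / 2 ≤ τ) :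
    Real.exp (1 / 2) * ∫ x, (max (x ^ 2 - τ) 0) ^ 2 ∂(gaussianReal 1 1) ≤ 6 := by
  have h : ∫ x, (max (x ^ 2 - τ) 0) ^ 2 ∂(gaussianReal 1 1) ≤ 0.04 * 76 := by
    rw [← integral_pow_six_gaussianReal_one, ← integral_const_mul]
    refine integral_mono (integrable_sq_max_sq_sub_gaussianReal τ 1 1)
      ((integrable_pow_gaussianReal 1 1 6).const_mul _) fun x => ?_
    have hx6 : x ^ 6 = (x ^ 2) ^ 3 := by ring
    simp only [hx6]
    have hu : 0 ≤ x ^ 2 := sq_nonneg x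
    generalize x ^ 2 = u at *
    have hmax : max (u - τ) 0 ≤ max (u - 9 / 2) 0 := by gcongr
    refine (pow_le_pow_left₀ (le_max_right _ _) hmax 2).trans ?_
    rcases le_total u (9 / 2) with h | h
    · rw [max_eq_right (by linarith)]
      simp only [ne_eq, OfNat.ofNat_ne_zero, not_false_eq_true, zero_pow]
      positivity
    · rw [max_eq_left (by linarith)]
      nlinarith [mul_nonneg hu (sq_nonneg (u - 13.5)), sq_nonneg (u - 13.5)]
  have he : Real.exp (1 / 2) ≤ 1.7 := by
    refine le_of_sq_le_sq ?_ (by norm_num)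
    rw [← Real.exp_nat_mul]
    norm_num
    linarith [Real.exp_one_lt_d9]
  calc _ ≤ 1.7 * (0.04 * 76 : ℝ) := by gcongr
    _ ≤ 6 := by norm_num

theorem two_le_mul_exp_of_le {τ : ℝ} (h1 : 1 ≤ τ) (h : τ ≤ 9 / 2) :
    2 ≤ (4 * √τ + 18) * Real.exp (-(τ / 2)) := by
  have hr : 1 ≤ √τ := Real.one_le_sqrt.2 h1
  have he : Real.exp (τ / 2) ≤ 11 := by
    refine (Real.exp_le_exp.2 (show τ / 2 ≤ (3 : ℕ) * 3 / 4 by push_cast; linarith)).trans ?_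
    refine le_of_pow_le_pow_left₀ (n := 4) (by norm_num) (by norm_num) ?_
    rw [← Real.exp_nat_mul]
    calc Real.exp _ = Real.exp 1 ^ 9 := by rw [← Real.exp_nat_mul]; norm_num
      _ ≤ 2.72 ^ 9 := by gcongr; linarith [Real.exp_one_lt_d9]
      _ ≤ _ := by norm_num
  rw [Real.exp_neg, ← div_eq_mul_inv, le_div_iff₀ (Real.exp_pos _)]
  linarith

theorem variance_max_sq_sub_gaussianReal_one_le {τ : ℝ} (hτ : 1 ≤ τ) (a : ℝ) :
    variance (fun x => max (x ^ 2 - τ) 0) (gaussianReal a 1) ≤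
      6 * a ^ 2 + (4 * √τ + 18) * Real.exp (-(τ / 2)) := by
  have hvar : variance (fun x => max (x ^ 2 - τ) 0) (gaussianReal a 1) ≤ 4 * a ^ 2 + 2 :=
    (variance_max_sub_const_zero_le (memLp_sq_gaussianReal a 1) τ).trans_eq
      (variance_sq_gaussianReal_one a)
  have hC : 0 ≤ (4 * √τ + 18) * Real.exp (-(τ / 2)) := by positivity
  rcases le_total τ (9 / 2) with h | h
  · nlinarith [two_le_mul_exp_of_le hτ h]
  rcases le_total (a ^ 2) 1 with ha | ha
  · have hsecond : ∫ x, (max (x ^ 2 - τ) 0) ^ 2 ∂(gaussianReal a 1) ≤ _ :=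
      integral_gaussianReal_one_le_of_even (by simp) (fun x => sq_nonneg _)
        (fun b => integrable_sq_max_sq_sub_gaussianReal τ b 1) ha
    have h0 := integral_sq_max_sq_sub_gaussianReal_zero_one_le_mul_exp h
    have h1 := exp_half_mul_integral_sq_max_sq_sub_gaussianReal_one_one_le h
    refine (variance_le_expectation_sq (by fun_prop)).trans (hsecond.trans ?_)
    have h0' := mul_le_mul_of_nonneg_left h0 (sub_nonneg.2 ha)
    have h1' := mul_le_mul_of_nonneg_left h1 (sq_nonneg a)
    nlinarith [mul_nonneg (sq_nonneg a) hC]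
  · linarith



/-- Let X ~ N(θ, 1/n) with n > 0 and τ ≥ 1, μ₀ = E_{θ=0}[(X² − τ/n)_+],
and ξ̂ = (X² − τ/n)_+ − μ₀. Then Var(ξ̂) ≤ 6θ²/n + (4τ^{1/2} + 18)/(n² e^{τ/2}). -/
theorem variance_thresholded_estimator (n : ℝ≥0) (hn : 0 < n) (τ : ℝ) (hτ : 1 ≤ τ)
    (θ : ℝ) (μ₀ : ℝ)
    (hμ₀ : μ₀ = ∫ x, max (x ^ 2 - τ / n) 0 ∂(gaussianReal 0 (1 / n))) :
    variance (fun x => max (x ^ 2 - τ / n) 0 - μ₀) (gaussianReal θ (1 / n))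
      ≤ 6 * θ ^ 2 / n + (4 * Real.sqrt τ + 18) / ((n : ℝ) ^ 2 * Real.exp (τ / 2)) := by
  set σ : ℝ≥0 := NNReal.sqrt (1 / n) with hσ
  have hn' : (0 : ℝ) < n := hn
  have hσpos : (0 : ℝ) < σ := by rw [hσ]; positivity
  have hσsq : (σ : ℝ) ^ 2 = 1 / n := by
    rw [← NNReal.coe_pow, hσ, NNReal.sq_sqrt]; simp
  have hmap : (gaussianReal (θ / σ) 1).map (fun x => (σ : ℝ) * x) = gaussianReal θ (1 / n) := by
    rw [gaussianReal_map_const_mul]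
    congr 1
    · field_simp
    · ext
      simp [hσsq]
  have hscale : (fun x : ℝ => max (x ^ 2 - τ / n) 0) ∘ (fun x => (σ : ℝ) * x) =
      fun x => (1 / n : ℝ) * max (x ^ 2 - τ) 0 := by
    ext x
    have : (0 : ℝ) ≤ 1 / n := by positivity
    rw [Function.comp_apply, mul_max_of_nonneg _ _ this, mul_pow, hσsq]
    congr 1 <;> ring
  rw [variance_sub_const (by fun_prop), ← hmap, variance_map (by fun_prop) (by fun_prop), hscale,
    variance_const_mul]
  refine (mul_le_mul_of_nonneg_left (variance_max_sq_sub_gaussianReal_one_le hτ (θ / σ))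
    (sq_nonneg _)).trans_eq ?_
  rw [div_pow θ, hσsq, Real.exp_neg]
  field_simp
end

section
/- Let X₁, X₂ be independent with Xᵢ ~ N(θᵢ, σ²), let ξ = θ₁² + θ₂² and λ ≥ 0. Then for every real x, P((X₁² − λ)_+ + (X₂² − λ)_+ ≥ x) ≤ P(((Z₁ + ξ^{1/2})² − λ)_+ + (Z₂² − λ)_+ ≥ x), where Z₁, Z₂ are independent N(0, σ²). That is, the sum of thresholded squares is stochastically maximized when all signal energy is concentrated in one coordinate. -/
open MeasureTheory ProbabilityTheory
open scoped NNReal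

lemma pow_add_pow_le_of_add_eq {p q u v : ℝ} (hv : 0 ≤ v) (hvp : v ≤ p) (hpu : p ≤ u)
    (h : p + q = u + v) (n : ℕ) : p ^ n + q ^ n ≤ u ^ n + v ^ n := by
  rcases (hvp.trans hpu).eq_or_lt with huv | huv
  · obtain rfl : p = v := by linarith
    obtain rfl : q = p := by linarith
    rw [huv]
  have hd : 0 < u - v := sub_pos.2 huv
  have hconv := (convexOn_pow (𝕜 := ℝ) n).2
  have ha : 0 ≤ (p - v) / (u - v) := div_nonneg (by linarith) hd.le
  have hb : 0 ≤ (u - p) / (u - v) := div_nonneg (by linarith) hd.le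
  have hab : (p - v) / (u - v) + (u - p) / (u - v) = 1 := by field_simp; ring
  have hu : u ∈ Set.Ici (0 : ℝ) := hv.trans huv.le
  have hv' : v ∈ Set.Ici (0 : ℝ) := hv
  have h₁ := hconv hu hv' ha hb hab
  have h₂ := hconv hu hv' hb ha (by rw [add_comm]; exact hab)
  simp only [smul_eq_mul] at h₁ h₂
  have e₁ : (p - v) / (u - v) * u + (u - p) / (u - v) * v = p := by field_simp; ring
  have e₂ : (u - p) / (u - v) * u + (p - v) / (u - v) * v = q := by
    obtain rfl : q = u + v - p := by linarith
    field_simp; ring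
  rw [e₁] at h₁
  rw [e₂] at h₂
  have e₃ : (u - p) / (u - v) = 1 - (p - v) / (u - v) := by linarith
  rw [e₃] at h₁ h₂
  linarith

/-- The map `(a, b) ↦ cosh a + cosh b` is Schur-convex in `(a², b²)`. -/
lemma cosh_add_cosh_le {a b c d : ℝ} (h : c ^ 2 + d ^ 2 = a ^ 2 + b ^ 2)
    (hmax : max (c ^ 2) (d ^ 2) ≤ max (a ^ 2) (b ^ 2)) :
    Real.cosh c + Real.cosh d ≤ Real.cosh a + Real.cosh b := by
  refine hasSum_le (fun n => ?_) ((Real.hasSum_cosh c).add (Real.hasSum_cosh d))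
    ((Real.hasSum_cosh a).add (Real.hasSum_cosh b))
  rw [← add_div, ← add_div]
  refine div_le_div_of_nonneg_right ?_ (by positivity)
  simp only [pow_mul]
  obtain ⟨hc, hd⟩ := max_le_iff.1 hmax
  rcases le_total (b ^ 2) (a ^ 2) with hab | hab
  · rw [max_eq_left hab] at hc hd
    exact pow_add_pow_le_of_add_eq (sq_nonneg b) (by linarith) hc h n
  · rw [max_eq_right hab] at hc hd
    rw [add_comm ((a ^ 2) ^ n)]
    exact pow_add_pow_le_of_add_eq (sq_nonneg a) (by linarith) hc (by linarith) n

lemma max_sub_add_max_sub_le {p q p' q' l : ℝ} (h : p + q = p' + q')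
    (hmax : max p q ≤ max p' q') :
    max (p - l) 0 + max (q - l) 0 ≤ max (p' - l) 0 + max (q' - l) 0 := by
  grind

/-- The plane linear map with matrix `!![a, b; c, d]`. -/
noncomputable def planeMap (a b c d : ℝ) : ℝ × ℝ →ₗ[ℝ] ℝ × ℝ :=
  Matrix.toLin (Module.Basis.finTwoProd ℝ) (Module.Basis.finTwoProd ℝ) !![a, b; c, d]

lemma planeMap_apply (a b c d : ℝ) (z : ℝ × ℝ) :
    planeMap a b c d z = (a * z.1 + b * z.2, c * z.1 + d * z.2) := by
  simp [planeMap, Matrix.toLin_finTwoProd_apply]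

lemma measurePreserving_planeMap {a b c d : ℝ} (h : |a * d - b * c| = 1) :
    MeasurePreserving (planeMap a b c d) := by
  have hdet : LinearMap.det (planeMap a b c d) = a * d - b * c := by
    rw [planeMap, LinearMap.det_toLin, Matrix.det_fin_two_of]
  refine ⟨(LinearMap.continuous_of_finiteDimensional _).measurable, ?_⟩
  have h0 : LinearMap.det (planeMap a b c d) ≠ 0 := by
    rw [hdet]; intro h0; simp [h0] at h
  rw [Measure.map_linearMap_addHaar_eq_smul_addHaar _ h0, hdet, abs_inv, h]
  simp

/-- The density of the product of two Gaussians with means `m.1`, `m.2` and variance `v`. -/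
noncomputable def planeGaussianPDF (v : ℝ≥0) (m z : ℝ × ℝ) : ℝ :=
  gaussianPDFReal m.1 v z.1 * gaussianPDFReal m.2 v z.2

lemma measurable_planeGaussianPDF (v : ℝ≥0) (m : ℝ × ℝ) :
    Measurable (planeGaussianPDF v m) :=
  ((measurable_gaussianPDFReal _ _).comp measurable_fst).mul
    ((measurable_gaussianPDFReal _ _).comp measurable_snd)

lemma planeGaussianPDF_nonneg (v : ℝ≥0) (m z : ℝ × ℝ) : 0 ≤ planeGaussianPDF v m z :=
  mul_nonneg (gaussianPDFReal_nonneg _ _ _) (gaussianPDFReal_nonneg _ _ _)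

lemma gaussianReal_prod_apply {v : ℝ≥0} (hv : v ≠ 0) (m : ℝ × ℝ) {B : Set (ℝ × ℝ)}
    (hB : MeasurableSet B) :
    ((gaussianReal m.1 v).prod (gaussianReal m.2 v)) B
      = ∫⁻ z in B, ENNReal.ofReal (planeGaussianPDF v m z) := by
  rw [gaussianReal_of_var_ne_zero _ hv, gaussianReal_of_var_ne_zero _ hv,
    prod_withDensity (measurable_gaussianPDF _ _) (measurable_gaussianPDF _ _),
    withDensity_apply _ hB, ← Measure.volume_eq_prod]
  refine lintegral_congr fun z => ?_
  rw [planeGaussianPDF, ENNReal.ofReal_mul (gaussianPDFReal_nonneg _ _ _)]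
  rfl

/-- The sum of the density over the orbit of `z` under the quarter turn. -/
noncomputable def quarterTurnSum (v : ℝ≥0) (m z : ℝ × ℝ) : ℝ :=
  planeGaussianPDF v m z + planeGaussianPDF v m (-z.2, z.1)
    + planeGaussianPDF v m (-z.1, -z.2) + planeGaussianPDF v m (z.2, -z.1)

lemma measurable_quarterTurnSum (v : ℝ≥0) (m : ℝ × ℝ) : Measurable (quarterTurnSum v m) := by
  have h := measurable_planeGaussianPDF v m
  unfold quarterTurnSum
  exact ((h.add (h.comp (by fun_prop))).add (h.comp (by fun_prop))).add (h.comp (by fun_prop))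

lemma quarterTurnSum_eq (v : ℝ≥0) (hv : v ≠ 0) (m z : ℝ × ℝ) :
    quarterTurnSum v m z = 2 * (√(2 * Real.pi * v))⁻¹ ^ 2
      * Real.exp (-(z.1 ^ 2 + z.2 ^ 2 + (m.1 ^ 2 + m.2 ^ 2)) / (2 * v))
      * (Real.cosh ((m.1 * z.1 + m.2 * z.2) / v) + Real.cosh ((m.2 * z.1 - m.1 * z.2) / v)) := by
  have hv' : (v : ℝ) ≠ 0 := by exact_mod_cast hv
  have key : ∀ x y : ℝ, planeGaussianPDF v m (x, y) = (√(2 * Real.pi * v))⁻¹ ^ 2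
      * (Real.exp (-(x ^ 2 + y ^ 2 + (m.1 ^ 2 + m.2 ^ 2)) / (2 * v))
        * Real.exp ((m.1 * x + m.2 * y) / v)) := by
    intro x y
    rw [planeGaussianPDF, gaussianPDFReal, gaussianPDFReal, mul_mul_mul_comm, ← Real.exp_add,
      ← Real.exp_add, ← sq]
    congr 2
    field_simp
    ring
  rw [quarterTurnSum, show planeGaussianPDF v m z = planeGaussianPDF v m (z.1, z.2) from rfl,
    key, key, key, key, Real.cosh_eq, Real.cosh_eq]
  have e₁ : (m.1 * -z.2 + m.2 * z.1) / (v : ℝ) = (m.2 * z.1 - m.1 * z.2) / v := by ring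
  have e₂ : (m.1 * -z.1 + m.2 * -z.2) / (v : ℝ) = -((m.1 * z.1 + m.2 * z.2) / v) := by ring
  have e₃ : (m.1 * z.2 + m.2 * -z.1) / (v : ℝ) = -((m.2 * z.1 - m.1 * z.2) / v) := by ring
  rw [e₁, e₂, e₃]
  simp only [neg_sq, add_comm (z.2 ^ 2) (z.1 ^ 2)]
  ring

lemma four_mul_setLIntegral_eq {v : ℝ≥0} (m : ℝ × ℝ) {B : Set (ℝ × ℝ)} (hB : MeasurableSet B)
    (hJ : ∀ z : ℝ × ℝ, (-z.2, z.1) ∈ B ↔ z ∈ B) :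
    4 * ∫⁻ z in B, ENNReal.ofReal (planeGaussianPDF v m z)
      = ∫⁻ z in B, ENNReal.ofReal (quarterTurnSum v m z) := by
  have hmp : MeasurePreserving (fun z : ℝ × ℝ => (-z.2, z.1)) := by
    have := measurePreserving_planeMap (a := 0) (b := -1) (c := 1) (d := 0) (by norm_num)
    convert this using 1
    funext z
    simp [planeMap_apply]
  have hpre : (fun z : ℝ × ℝ => (-z.2, z.1)) ⁻¹' B = B := Set.ext hJ
  have turn : ∀ f : ℝ × ℝ → ENNReal, Measurable f →
      ∫⁻ z in B, f (-z.2, z.1) = ∫⁻ z in B, f z := by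
    intro f hf
    have := hmp.setLIntegral_comp_preimage hB hf
    rwa [hpre] at this
  have hm : Measurable fun z => ENNReal.ofReal (planeGaussianPDF v m z) :=
    (measurable_planeGaussianPDF v m).ennreal_ofReal
  have hmg : ∀ g : ℝ × ℝ → ℝ × ℝ, Measurable g →
      Measurable fun z => ENNReal.ofReal (planeGaussianPDF v m (g z)) :=
    fun g hg => hm.comp hg
  have hm₁ := hmg (fun z => (-z.2, z.1)) (by fun_prop)
  have hm₂ := hmg (fun z => (-z.1, -z.2)) (by fun_prop)
  have hm₃ := hmg (fun z => (z.2, -z.1)) (by fun_prop)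
  have h₁ := turn _ hm
  have h₂ := turn _ hm₁
  have h₃ := turn _ hm₂
  simp only [neg_neg] at h₂ h₃
  have hnn := planeGaussianPDF_nonneg v m
  have hsum : ∀ z, ENNReal.ofReal (quarterTurnSum v m z)
      = ENNReal.ofReal (planeGaussianPDF v m z)
        + ENNReal.ofReal (planeGaussianPDF v m (-z.2, z.1))
        + ENNReal.ofReal (planeGaussianPDF v m (-z.1, -z.2))
        + ENNReal.ofReal (planeGaussianPDF v m (z.2, -z.1)) := by
    intro z
    rw [quarterTurnSum, ENNReal.ofReal_add (add_nonneg (add_nonneg (hnn _) (hnn _)) (hnn _))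
      (hnn _), ENNReal.ofReal_add (add_nonneg (hnn _) (hnn _)) (hnn _),
      ENNReal.ofReal_add (hnn _) (hnn _)]
  simp only [hsum]
  rw [lintegral_add_right _ hm₃, lintegral_add_right _ hm₂, lintegral_add_right _ hm₁,
    h₃, h₂, h₁]
  ring

/-- A two-point rearrangement inequality for a measure-preserving involution. -/
lemma setLIntegral_comp_involutive_le {α : Type*} [MeasurableSpace α] {μ : Measure α}
    {ρ : α → α} (hρ : MeasurePreserving ρ μ μ) (hinv : Function.Involutive ρ) {B : Set α}
    (hB : MeasurableSet B) {G : α → ENNReal} (hG : Measurable G)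
    (h : ∀ z, z ∈ B → ρ z ∉ B → G (ρ z) ≤ G z) :
    ∫⁻ z in B, G (ρ z) ∂μ ≤ ∫⁻ z in B, G z ∂μ := by
  have hBρ : MeasurableSet (ρ ⁻¹' B) := hρ.measurable hB
  have hpre : ρ ⁻¹' (B ∩ ρ ⁻¹' B) = B ∩ ρ ⁻¹' B := by
    ext z
    simp only [Set.mem_preimage, Set.mem_inter_iff, hinv z, and_comm]
  have e := hρ.setLIntegral_comp_preimage (hB.inter hBρ) hG
  rw [hpre] at e
  rw [← lintegral_inter_add_sdiff (fun z => G (ρ z)) B hBρ,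
    ← lintegral_inter_add_sdiff G B hBρ, e]
  gcongr 1
  exact setLIntegral_mono' (hB.diff hBρ) fun z hz => h z hz.1 hz.2

/-- A quarter-turn invariant set `B` whose indicator is, on each circle centred at the origin,
monotone in `max (z.1 ^ 2) (z.2 ^ 2)` has largest Gaussian measure, among means of a given norm,
when the mean lies on the first axis. -/
lemma gaussianReal_prod_le_of_mean_axis {v : ℝ≥0} (hv : v ≠ 0) {B : Set (ℝ × ℝ)}
    (hB : MeasurableSet B) (hJ : ∀ z : ℝ × ℝ, (-z.2, z.1) ∈ B ↔ z ∈ B)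
    (hmono : ∀ z w : ℝ × ℝ, z.1 ^ 2 + z.2 ^ 2 = w.1 ^ 2 + w.2 ^ 2 →
      max (z.1 ^ 2) (z.2 ^ 2) ≤ max (w.1 ^ 2) (w.2 ^ 2) → z ∈ B → w ∈ B)
    {c s : ℝ} (hcs : c ^ 2 + s ^ 2 = 1) (t : ℝ) :
    ((gaussianReal (t * c) v).prod (gaussianReal (t * s) v)) B
      ≤ ((gaussianReal t v).prod (gaussianReal 0 v)) B := by
  rw [gaussianReal_prod_apply hv (t * c, t * s) hB, gaussianReal_prod_apply hv (t, 0) hB,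
    ← ENNReal.mul_le_mul_iff_right (a := 4) (by norm_num) (by norm_num),
    four_mul_setLIntegral_eq _ hB hJ, four_mul_setLIntegral_eq _ hB hJ]
  have hnorm : ∀ z : ℝ × ℝ,
      (c * z.1 + s * z.2) ^ 2 + (s * z.1 + -c * z.2) ^ 2 = z.1 ^ 2 + z.2 ^ 2 := fun z => by
    linear_combination (z.1 ^ 2 + z.2 ^ 2) * hcs
  have hrot : ∀ z, quarterTurnSum v (t * c, t * s) z
      = quarterTurnSum v (t, 0) (planeMap c s s (-c) z) := by
    intro z
    rw [quarterTurnSum_eq v hv, quarterTurnSum_eq v hv, planeMap_apply]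
    dsimp only
    have e₁ : (t * c) ^ 2 + (t * s) ^ 2 = t ^ 2 + 0 ^ 2 := by
      linear_combination t ^ 2 * hcs
    have e₂ : t * c * z.1 + t * s * z.2 = t * (c * z.1 + s * z.2) + 0 * (s * z.1 + -c * z.2) := by
      ring
    have e₃ : (t * s * z.1 - t * c * z.2) / v
        = -((0 * (c * z.1 + s * z.2) - t * (s * z.1 + -c * z.2)) / v) := by
      ring
    rw [hnorm, e₁, e₂, e₃, Real.cosh_neg]
  simp only [hrot]
  refine setLIntegral_comp_involutive_le (G := fun z => ENNReal.ofReal (quarterTurnSum v (t, 0) z))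
    (measurePreserving_planeMap ?_) (fun z => ?_) hB
    (measurable_quarterTurnSum v _).ennreal_ofReal fun z hz hρz => ?_
  · rw [show c * -c - s * s = -1 by linear_combination -hcs]
    norm_num
  · simp only [planeMap_apply]
    ext
    · linear_combination z.1 * hcs
    · linear_combination z.2 * hcs
  · apply ENNReal.ofReal_le_ofReal
    rw [planeMap_apply] at hρz ⊢
    have hmax : max ((c * z.1 + s * z.2) ^ 2) ((s * z.1 + -c * z.2) ^ 2)
        ≤ max (z.1 ^ 2) (z.2 ^ 2) :=
      le_of_not_ge fun h => hρz (hmono z _ (hnorm z).symm h hz)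
    rw [quarterTurnSum_eq v hv, quarterTurnSum_eq v hv]
    dsimp only
    rw [hnorm]
    refine mul_le_mul_of_nonneg_left (cosh_add_cosh_le ?_ ?_) (by positivity)
    · linear_combination (t / v) ^ 2 * hnorm z
    · have hscale : ∀ a b : ℝ, max (((t * a + 0 * b) / v) ^ 2) (((0 * a - t * b) / v) ^ 2)
          = (t / v) ^ 2 * max (a ^ 2) (b ^ 2) := by
        intro a b
        rw [mul_max_of_nonneg _ _ (sq_nonneg _)]
        congr 1 <;> ring
      rw [hscale, hscale]
      gcongr

/-- Let X₁, X₂ be independent with Xᵢ ~ N(θᵢ, σ²), ξ = θ₁² + θ₂² and λ ≥ 0.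
Then for every real x,
P((X₁² − λ)_+ + (X₂² − λ)_+ ≥ x)
  ≤ P(((Z₁ + ξ^{1/2})² − λ)_+ + (Z₂² − λ)_+ ≥ x),
where Z₁, Z₂ are independent N(0, σ²); i.e. the sum of thresholded squares is
stochastically maximized when all the signal energy is in one coordinate. -/
theorem thresholded_sum_stochastically_maximized
    (θ₁ θ₂ : ℝ) (σ2 : ℝ≥0) (hσ : 0 < σ2) (lam : ℝ) (hlam : 0 ≤ lam)
    (ξ : ℝ) (hξ : ξ = θ₁ ^ 2 + θ₂ ^ 2) (x : ℝ) :
    ((gaussianReal θ₁ σ2).prod (gaussianReal θ₂ σ2))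
        {p : ℝ × ℝ | x ≤ max (p.1 ^ 2 - lam) 0 + max (p.2 ^ 2 - lam) 0}
      ≤ ((gaussianReal 0 σ2).prod (gaussianReal 0 σ2))
        {p : ℝ × ℝ |
          x ≤ max ((p.1 + Real.sqrt ξ) ^ 2 - lam) 0 + max (p.2 ^ 2 - lam) 0} := by
  set B : Set (ℝ × ℝ) := {p | x ≤ max (p.1 ^ 2 - lam) 0 + max (p.2 ^ 2 - lam) 0} with hBdef
  have hB : MeasurableSet B := measurableSet_le measurable_const (by fun_prop)
  have hξ0 : 0 ≤ ξ := by rw [hξ]; positivity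
  have hshift : ((gaussianReal 0 σ2).prod (gaussianReal 0 σ2))
      {p : ℝ × ℝ | x ≤ max ((p.1 + √ξ) ^ 2 - lam) 0 + max (p.2 ^ 2 - lam) 0}
      = ((gaussianReal √ξ σ2).prod (gaussianReal 0 σ2)) B := by
    have h := Measure.map_prod_map (gaussianReal 0 σ2) (gaussianReal 0 σ2)
      (measurable_id.add_const √ξ) measurable_id
    rw [Measure.map_id, show (fun a : ℝ => id a + √ξ) = (· + √ξ) from rfl,
      gaussianReal_map_add_const, zero_add] at h
    rw [h, Measure.map_apply (by fun_prop) hB]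
    rfl
  obtain ⟨c, s, hcs, hc, hs⟩ : ∃ c s : ℝ, c ^ 2 + s ^ 2 = 1 ∧ θ₁ = √ξ * c ∧ θ₂ = √ξ * s := by
    rcases hξ0.eq_or_lt with h0 | hpos
    · have h₁ : θ₁ = 0 := by nlinarith [sq_nonneg θ₁, sq_nonneg θ₂]
      have h₂ : θ₂ = 0 := by nlinarith [sq_nonneg θ₁, sq_nonneg θ₂]
      exact ⟨1, 0, by norm_num, by simp [h₁, ← h0], by simp [h₂]⟩
    · have ht : √ξ ≠ 0 := (Real.sqrt_pos.2 hpos).ne'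
      refine ⟨θ₁ / √ξ, θ₂ / √ξ, ?_, by field_simp, by field_simp⟩
      rw [div_pow, div_pow, Real.sq_sqrt hξ0, ← add_div, ← hξ, div_self hpos.ne']
  rw [hshift, hc, hs]
  refine gaussianReal_prod_le_of_mean_axis hσ.ne' hB (fun z => ?_) (fun z w h hmax hz => ?_) hcs √ξ
  · simp only [hBdef, Set.mem_ofPred_eq, neg_sq]
    rw [add_comm]
  · exact le_trans hz (max_sub_add_max_sub_le h hmax)
end

section
/- Let X₁,…,X_m be independent with Xᵢ ~ N(θᵢ, σ²), ξ = Σᵢ θᵢ², and λ ≥ 0. Then for every real x, P(Σᵢ (Xᵢ² − λ)_+ ≥ x) ≤ P(((Z₁ + ξ^{1/2})² − λ)_+ + Σ_{i=2}^m (Zᵢ² − λ)_+ ≥ x), where Z₁,…,Z_m are i.i.d. N(0, σ²). -/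
open MeasureTheory ProbabilityTheory
open scoped NNReal ENNReal

theorem ConvexOn.add_le_add_of_abs_sub_le {G : ℝ → ℝ} (hG : ConvexOn ℝ (Set.Ici 0) G)
    {u w u' w' : ℝ} (hu' : 0 ≤ u') (hw' : 0 ≤ w')
    (hsum : u + w = u' + w') (hd : |u - w| ≤ |u' - w'|) : G u + G w ≤ G u' + G w' := by
  rcases eq_or_ne u' w' with rfl | hne
  · have h0 : u - w = 0 := by simpa using hd
    obtain rfl : u = w := by linarith
    obtain rfl : u = u' := by linarith
    rfl
  · have hne' : u' - w' ≠ 0 := sub_ne_zero.mpr hne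
    have ht : |(u - w) / (u' - w')| ≤ 1 := by
      rw [abs_div]
      exact div_le_one_of_le₀ hd (abs_nonneg _)
    obtain ⟨s, hs⟩ : ∃ s, s = (u - w) / (u' - w') := ⟨_, rfl⟩
    rw [← hs] at ht
    have hs' : s * (u' - w') = u - w := by rw [hs]; field_simp
    obtain ⟨h1, h2⟩ := abs_le.mp ht
    have hu := hG.2 (Set.mem_Ici.mpr hu') (Set.mem_Ici.mpr hw')
      (show 0 ≤ (1 + s) / 2 by linarith) (show 0 ≤ (1 - s) / 2 by linarith) (by ring)
    have hw := hG.2 (Set.mem_Ici.mpr hu') (Set.mem_Ici.mpr hw')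
      (show 0 ≤ (1 - s) / 2 by linarith) (show 0 ≤ (1 + s) / 2 by linarith) (by ring)
    simp only [smul_eq_mul] at hu hw
    rw [show (1 + s) / 2 * u' + (1 - s) / 2 * w' = u by linarith] at hu
    rw [show (1 - s) / 2 * u' + (1 + s) / 2 * w' = w by linarith] at hw
    linarith

theorem cosh_add_cosh_le_s9 {a b a' b' : ℝ} (hsum : a ^ 2 + b ^ 2 = a' ^ 2 + b' ^ 2)
    (hd : |a ^ 2 - b ^ 2| ≤ |a' ^ 2 - b' ^ 2|) :
    Real.cosh a + Real.cosh b ≤ Real.cosh a' + Real.cosh b' := by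
  refine hasSum_le (fun n => ?_) ((Real.hasSum_cosh a).add (Real.hasSum_cosh b))
    ((Real.hasSum_cosh a').add (Real.hasSum_cosh b'))
  rw [← add_div, ← add_div]
  gcongr ?_ / _
  simpa only [pow_mul] using
    (convexOn_pow n).add_le_add_of_abs_sub_le (sq_nonneg a') (sq_nonneg b') hsum hd

theorem convexOn_max_sub (lam : ℝ) : ConvexOn ℝ (Set.Ici 0) fun u : ℝ => max (u - lam) 0 :=
  ((convexOn_id (convex_Ici 0)).sub (concaveOn_const lam (convex_Ici 0))).sup
    (convexOn_const 0 (convex_Ici 0))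

theorem ENNReal.mul_add_mul_le_mul_add_mul {a b c d : ℝ≥0∞} (hab : a ≤ b) (hcd : c ≤ d) :
    a * d + b * c ≤ a * c + b * d := by
  obtain ⟨e, rfl⟩ := exists_add_of_le hcd
  calc a * (c + e) + b * c = a * c + b * c + a * e := by ring
    _ ≤ a * c + b * c + b * e := by gcongr
    _ = a * c + b * (c + e) := by ring

theorem MeasureTheory.MeasurePreserving.lintegral_mul_comp_le {α : Type*} [MeasurableSpace α]
    {μ : Measure α} {R : α → α} (hR : MeasurePreserving R μ μ) (hinv : Function.Involutive R)
    {S h : α → ℝ≥0∞} (hS : Measurable S) (hh : Measurable h)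
    (hmono : ∀ z, (S z ≤ S (R z) ∧ h z ≤ h (R z)) ∨ (S (R z) ≤ S z ∧ h (R z) ≤ h z)) :
    ∫⁻ z, S z * h (R z) ∂μ ≤ ∫⁻ z, S z * h z ∂μ := by
  have hhR := hh.comp hR.measurable
  have h1 : ∫⁻ z, S (R z) * h z ∂μ = ∫⁻ z, S z * h (R z) ∂μ := by
    rw [← hR.lintegral_comp (f := fun z => S z * h (R z)) (hS.mul hhR)]
    simp [hinv _]
  have h2 : ∫⁻ z, S (R z) * h (R z) ∂μ = ∫⁻ z, S z * h z ∂μ := hR.lintegral_comp (hS.mul hh)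
  have key : ∫⁻ z, (S z * h (R z) + S (R z) * h z) ∂μ
      ≤ ∫⁻ z, (S z * h z + S (R z) * h (R z)) ∂μ := by
    refine lintegral_mono fun z => ?_
    rcases hmono z with ⟨h1, h2⟩ | ⟨h1, h2⟩
    · exact ENNReal.mul_add_mul_le_mul_add_mul h1 h2
    · rw [add_comm, add_comm (S z * h z)]
      exact ENNReal.mul_add_mul_le_mul_add_mul h1 h2
  rw [lintegral_add_left (f := fun z => S z * h (R z)) (hS.mul hhR),
    lintegral_add_left (f := fun z => S z * h z) (hS.mul hh), h1, h2, ← two_mul,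
    ← two_mul] at key
  exact (ENNReal.mul_le_mul_iff_right two_ne_zero ENNReal.ofNat_ne_top).mp key

theorem MeasureTheory.MeasurePreserving.lintegral_sum_iterate_mul {α : Type*} [MeasurableSpace α]
    {μ : Measure α} {Q : α → α} (hQ : MeasurePreserving Q μ μ) {k h : α → ℝ≥0∞}
    (hk : Measurable k) (hh : Measurable h) (hinv : ∀ z, h (Q z) = h z) (n : ℕ) :
    ∫⁻ z, (∑ j ∈ Finset.range n, k (Q^[j] z)) * h z ∂μ = n * ∫⁻ z, k z * h z ∂μ := by
  have hit : ∀ j z, h (Q^[j] z) = h z := fun j => by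
    induction j with
    | zero => simp
    | succ j ih => intro z; rw [Function.iterate_succ_apply, ih, hinv]
  simp_rw [Finset.sum_mul]
  rw [lintegral_finsetSum (f := fun j z => k (Q^[j] z) * h z) _ fun j _ =>
    (hk.comp (hQ.measurable.iterate j)).mul hh]
  have : ∀ j, ∫⁻ z, k (Q^[j] z) * h z ∂μ = ∫⁻ z, k z * h z ∂μ := fun j => by
    rw [← (hQ.iterate j).lintegral_comp (f := fun z => k z * h z) (hk.mul hh)]
    simp [hit]
  simp [this]

theorem gaussianPDF_mul_gaussianPDF (a b : ℝ) (v : ℝ≥0) (z : ℂ) :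
    gaussianPDF a v z.re * gaussianPDF b v z.im =
      ENNReal.ofReal ((√(2 * Real.pi * v))⁻¹ ^ 2 *
        Real.exp (-((z.re - a) ^ 2 + (z.im - b) ^ 2) / (2 * v))) := by
  rw [gaussianPDF, gaussianPDF, ← ENNReal.ofReal_mul (gaussianPDFReal_nonneg _ _ _),
    gaussianPDFReal, gaussianPDFReal, neg_add, add_div, Real.exp_add]
  ring_nf

theorem sum_rotations_gaussianPDF (r : ℝ) {v : ℝ≥0} (hv : v ≠ 0) (z : ℂ) :
    ∑ j ∈ Finset.range 4, gaussianPDF r v ((fun z => Complex.I * z)^[j] z).re *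
        gaussianPDF 0 v ((fun z => Complex.I * z)^[j] z).im =
      ENNReal.ofReal ((√(2 * Real.pi * v))⁻¹ ^ 2 *
        Real.exp (-((z.re ^ 2 + z.im ^ 2) + r ^ 2) / (2 * v)) *
          (2 * (Real.cosh (r / v * z.re) + Real.cosh (r / v * z.im)))) := by
  have hv' : (v : ℝ) ≠ 0 := by exact_mod_cast hv
  have hexp : ∀ p q : ℝ, p ^ 2 + q ^ 2 = z.re ^ 2 + z.im ^ 2 →
      Real.exp (-((p - r) ^ 2 + (q - 0) ^ 2) / (2 * v)) =
        Real.exp (-((z.re ^ 2 + z.im ^ 2) + r ^ 2) / (2 * v)) * Real.exp (r / v * p) := by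
    intro p q h
    rw [← Real.exp_add, ← h]
    congr 1
    field_simp
    ring
  simp_rw [gaussianPDF_mul_gaussianPDF]
  rw [← ENNReal.ofReal_sum_of_nonneg fun _ _ => by positivity]
  congr 1
  simp only [Finset.sum_range_succ, Finset.sum_range_zero, Function.iterate_succ_apply,
    Function.iterate_zero_apply, Complex.I_mul_re, Complex.I_mul_im]
  rw [hexp z.re z.im rfl, hexp (-z.im) z.re (by ring), hexp (-z.re) (-z.im) (by ring),
    hexp (- -z.im) (-z.re) (by ring), Real.cosh_eq, Real.cosh_eq]
  ring_nf

theorem lintegral_gaussianReal_prod {v : ℝ≥0} (hv : v ≠ 0) (a b : ℝ) {g : ℝ → ℝ → ℝ≥0∞}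
    (hg : Measurable (Function.uncurry g)) :
    ∫⁻ y, ∫⁻ y', g y y' ∂gaussianReal b v ∂gaussianReal a v =
      ∫⁻ z : ℂ, gaussianPDF a v z.re * gaussianPDF b v z.im * g z.re z.im := by
  change ∫⁻ y, ∫⁻ y', Function.uncurry g (y, y') ∂gaussianReal b v ∂gaussianReal a v = _
  rw [← lintegral_prod (Function.uncurry g) hg.aemeasurable,
    gaussianReal_of_var_ne_zero _ hv, gaussianReal_of_var_ne_zero _ hv,
    prod_withDensity (by fun_prop) (by fun_prop),
    lintegral_withDensity_eq_lintegral_mul _ (by fun_prop) hg,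
    ← Measure.volume_eq_prod,
    ← Complex.volume_preserving_equiv_real_prod.lintegral_comp 
      (by exact Measurable.mul (by fun_prop) hg)]
  rfl

theorem exists_linearIsometryEquiv_reflection {a b r : ℝ} (hr : r ≠ 0)
    (hr2 : r ^ 2 = a ^ 2 + b ^ 2) :
    ∃ R : ℂ ≃ₗᵢ[ℝ] ℂ, (∀ z, (R z).re = (a * z.re + b * z.im) / r) ∧
      ∀ z, (R z).im = (b * z.re - a * z.im) / r := by
  let e : Circle := ⟨⟨a / r, b / r⟩, by
    rw [Submonoid.unitSphere, ← SetLike.mem_coe]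
    simp only [Submonoid.coe_set_mk, Subsemigroup.coe_set_mk, mem_sphere_zero_iff_norm]
    rw [← sq_eq_sq₀ (norm_nonneg _) zero_le_one, Complex.sq_norm, Complex.normSq_mk]
    field_simp
    linarith⟩
  have hmul : ∀ z, Complex.conjLIE.trans (rotation e) z =
      (⟨a / r, b / r⟩ : ℂ) * (starRingEnd ℂ) z := fun _ => rfl
  refine ⟨Complex.conjLIE.trans (rotation e), fun z => ?_, fun z => ?_⟩
  · rw [hmul, Complex.mul_re, Complex.conj_re, Complex.conj_im]
    ring
  · rw [hmul, Complex.mul_im, Complex.conj_re, Complex.conj_im]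
    ring

theorem lintegral_threshold_pair_le {v : ℝ≥0} (hv : v ≠ 0) (lam a b : ℝ) {ψ : ℝ → ℝ≥0∞}
    (hψ : Monotone ψ) :
    ∫⁻ y, ∫⁻ y', ψ (max (y ^ 2 - lam) 0 + max (y' ^ 2 - lam) 0)
        ∂gaussianReal b v ∂gaussianReal a v ≤
      ∫⁻ y, ∫⁻ y', ψ (max (y ^ 2 - lam) 0 + max (y' ^ 2 - lam) 0)
        ∂gaussianReal 0 v ∂gaussianReal (√(a ^ 2 + b ^ 2)) v := by
  have hg : Measurable (Function.uncurry fun y y' : ℝ =>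
      ψ (max (y ^ 2 - lam) 0 + max (y' ^ 2 - lam) 0)) :=
    hψ.measurable.comp (by fun_prop)
  rw [lintegral_gaussianReal_prod hv _ _ hg, lintegral_gaussianReal_prod hv _ _ hg]
  obtain ⟨r, hr⟩ : ∃ r, r = √(a ^ 2 + b ^ 2) := ⟨_, rfl⟩
  rw [← hr]
  have hr2 : r ^ 2 = a ^ 2 + b ^ 2 := by rw [hr, Real.sq_sqrt (by positivity)]
  rcases eq_or_ne r 0 with hr0 | hr0
  · obtain rfl : a = 0 := by nlinarith [sq_nonneg a, sq_nonneg b]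
    obtain rfl : b = 0 := by nlinarith [sq_nonneg b]
    rw [hr0]
  set h : ℂ → ℝ≥0∞ := fun z => ψ (max (z.re ^ 2 - lam) 0 + max (z.im ^ 2 - lam) 0) with hh_def
  have hh : Measurable h := hψ.measurable.comp (by fun_prop)
  obtain ⟨R, hRre, hRim⟩ := exists_linearIsometryEquiv_reflection hr0 hr2
  have hRmp : MeasurePreserving R := R.measurePreserving
  have hRinv : Function.Involutive R := fun z => by
    apply Complex.ext
    · rw [hRre, hRre, hRim]; field_simp; rw [hr2]; ring
    · rw [hRim, hRre, hRim]; field_simp; rw [hr2]; ring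
  have hRnorm : ∀ z, (R z).re ^ 2 + (R z).im ^ 2 = z.re ^ 2 + z.im ^ 2 := fun z => by
    rw [hRre, hRim]; field_simp; rw [hr2]; ring
  have hQmp : MeasurePreserving (fun z : ℂ => Complex.I * z) := by
    convert (rotation (Circle.exp (Real.pi / 2))).measurePreserving using 2 with z
    simp [rotation_apply, Circle.coe_exp, Complex.exp_pi_div_two_mul_I]
  have hQ : ∀ z, h (Complex.I * z) = h z := fun z => by
    simp [hh_def, add_comm]
  have hQR : ∀ z, h (R (Complex.I * z)) = h (R z) := fun z => by
    have h1 : (R (Complex.I * z)).re = (R z).im := by rw [hRre, hRim]; simp; ring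
    have h2 : (R (Complex.I * z)).im = -(R z).re := by rw [hRre, hRim]; simp; ring
    simp [hh_def, h1, h2, add_comm]
  set k : ℂ → ℝ≥0∞ := fun z => gaussianPDF r v z.re * gaussianPDF 0 v z.im with hk_def
  have hk : Measurable k := by fun_prop
  have hkR : ∀ z, gaussianPDF a v z.re * gaussianPDF b v z.im = k (R z) := fun z => by
    simp only [hk_def]
    rw [gaussianPDF_mul_gaussianPDF, gaussianPDF_mul_gaussianPDF]
    congr 4
    rw [hRre, hRim]; field_simp; rw [hr2]; ring
  have hL : ∫⁻ z : ℂ, gaussianPDF a v z.re * gaussianPDF b v z.im * h z =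
      ∫⁻ z : ℂ, k z * h (R z) := by
    simp_rw [hkR]
    rw [← hRmp.lintegral_comp (f := fun z => k z * h (R z)) (hk.mul (hh.comp hRmp.measurable))]
    simp [hRinv _]
  change ∫⁻ z : ℂ, gaussianPDF a v z.re * gaussianPDF b v z.im * h z ≤ ∫⁻ z : ℂ, k z * h z
  rw [hL, ← ENNReal.mul_le_mul_iff_right (a := (4 : ℕ)) (by simp) (by simp),
    ← hQmp.lintegral_sum_iterate_mul (h := fun z => h (R z)) hk (hh.comp hRmp.measurable) hQR,
    ← hQmp.lintegral_sum_iterate_mul hk hh hQ]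
  have hS : Measurable fun z => ∑ j ∈ Finset.range 4, k ((fun z => Complex.I * z)^[j] z) :=
    Finset.measurable_sum _ fun j _ => hk.comp (hQmp.measurable.iterate j)
  have hmono : ∀ z z' : ℂ, z.re ^ 2 + z.im ^ 2 = z'.re ^ 2 + z'.im ^ 2 →
      |z.re ^ 2 - z.im ^ 2| ≤ |z'.re ^ 2 - z'.im ^ 2| →
      ∑ j ∈ Finset.range 4, k ((fun z => Complex.I * z)^[j] z) ≤
        ∑ j ∈ Finset.range 4, k ((fun z => Complex.I * z)^[j] z') ∧ h z ≤ h z' := by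
    intro z z' hsum hd
    refine ⟨?_, hψ ?_⟩
    · simp only [hk_def]
      rw [sum_rotations_gaussianPDF r hv, sum_rotations_gaussianPDF r hv, hsum]
      gcongr ENNReal.ofReal (_ * (2 * ?_))
      apply cosh_add_cosh_le_s9
      · simp only [mul_pow, ← mul_add, hsum]
      · simp only [mul_pow, ← mul_sub, abs_mul]
        gcongr
    · exact (convexOn_max_sub lam).add_le_add_of_abs_sub_le (sq_nonneg _) (sq_nonneg _) hsum hd
  refine hRmp.lintegral_mul_comp_le hRinv hS hh fun z => ?_
  rcases le_total |z.re ^ 2 - z.im ^ 2| |(R z).re ^ 2 - (R z).im ^ 2| with hle | hle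
  · exact .inl (hmono _ _ (hRnorm z).symm hle)
  · exact .inr (hmono _ _ (hRnorm z) hle)

theorem pi_gaussianReal_threshold_succ {n : ℕ} (θ : Fin (n + 1) → ℝ) (v : ℝ≥0) (lam x : ℝ) :
    (Measure.pi fun i => gaussianReal (θ i) v)
        {y : Fin (n + 1) → ℝ | x ≤ ∑ i, max ((y i) ^ 2 - lam) 0} =
      ∫⁻ y, (Measure.pi fun i => gaussianReal (θ (Fin.succ i)) v)
        {y' : Fin n → ℝ | x - max (y ^ 2 - lam) 0 ≤ ∑ i, max ((y' i) ^ 2 - lam) 0}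
        ∂gaussianReal (θ 0) v := by
  have hs : MeasurableSet {p : ℝ × (Fin n → ℝ) |
      x ≤ max (p.1 ^ 2 - lam) 0 + ∑ i, max ((p.2 i) ^ 2 - lam) 0} :=
    measurableSet_le measurable_const (by fun_prop)
  have hmp := measurePreserving_piFinSuccAbove (fun i => gaussianReal (θ i) v) 0
  have hpre : {y : Fin (n + 1) → ℝ | x ≤ ∑ i, max ((y i) ^ 2 - lam) 0} =
      MeasurableEquiv.piFinSuccAbove (fun _ => ℝ) 0 ⁻¹' {p : ℝ × (Fin n → ℝ) |
        x ≤ max (p.1 ^ 2 - lam) 0 + ∑ i, max ((p.2 i) ^ 2 - lam) 0} := by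
    ext y
    simp only [Set.mem_ofPred_eq, Set.mem_preimage, Fin.sum_univ_succ]
    rfl
  rw [hpre, hmp.measure_preimage hs.nullMeasurableSet, Measure.prod_apply hs]
  simp only [Fin.succAbove_zero, Set.preimage_ofPred_eq, sub_le_iff_le_add']

theorem pi_gaussianReal_threshold_le {v : ℝ≥0} (hv : v ≠ 0) (lam : ℝ) {n : ℕ}
    (θ : Fin (n + 1) → ℝ) (x : ℝ) :
    (Measure.pi fun i => gaussianReal (θ i) v)
        {y : Fin (n + 1) → ℝ | x ≤ ∑ i, max ((y i) ^ 2 - lam) 0} ≤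
      (Measure.pi fun i : Fin (n + 1) => gaussianReal (if i = 0 then √(∑ i, θ i ^ 2) else 0) v)
        {y : Fin (n + 1) → ℝ | x ≤ ∑ i, max ((y i) ^ 2 - lam) 0} := by
  induction n generalizing x with
  | zero =>
    rw [pi_gaussianReal_threshold_succ, pi_gaussianReal_threshold_succ]
    have habs : √(∑ i, θ i ^ 2) = |θ 0| := by simp [Real.sqrt_sq_eq_abs]
    rw [if_pos rfl, habs, Subsingleton.elim (fun i : Fin 0 => gaussianReal (θ i.succ) v)
      fun i => gaussianReal (if i.succ = 0 then |θ 0| else 0) v]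
    rcases abs_choice (θ 0) with h | h
    · rw [h]
    · rw [h, ← gaussianReal_map_neg, 
        show (fun y : ℝ => -y) = MeasurableEquiv.neg ℝ from rfl, lintegral_map_equiv]
      simp
  | succ n ih =>
    rw [pi_gaussianReal_threshold_succ, pi_gaussianReal_threshold_succ]
    set ψ : ℝ → ℝ≥0∞ := fun s => (Measure.pi fun _ : Fin n => gaussianReal 0 v)
      {y : Fin n → ℝ | x - s ≤ ∑ i, max ((y i) ^ 2 - lam) 0} with hψ_def
    have hψ : Monotone ψ := fun s t hst => measure_mono fun y hy => by
      simp only [Set.mem_ofPred_eq] at hy ⊢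
      linarith
    have hpair := lintegral_threshold_pair_le hv lam (θ 0)
      (√(∑ i : Fin (n + 1), θ i.succ ^ 2)) hψ
    rw [Real.sq_sqrt (by positivity), ← Fin.sum_univ_succ (fun i => θ i ^ 2)] at hpair
    refine le_trans (lintegral_mono fun y => (ih (fun i => θ i.succ) _).trans_eq ?_)
      (hpair.trans_eq ?_)
    · rw [pi_gaussianReal_threshold_succ]
      simp [hψ_def, sub_sub]
    · simp only [Fin.succ_ne_zero, if_false]
      refine lintegral_congr fun y => ?_
      rw [pi_gaussianReal_threshold_succ (fun _ => 0)]
      simp [hψ_def, sub_sub]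

/-- Let X₁,…,X_m be independent with Xᵢ ~ N(θᵢ, σ²), ξ = Σᵢ θᵢ², and λ ≥ 0.
Then for every real x,
P(Σᵢ (Xᵢ² − λ)_+ ≥ x)
  ≤ P(((Z₁ + ξ^{1/2})² − λ)_+ + Σ_{i=2}^m (Zᵢ² − λ)_+ ≥ x),
where Z₁,…,Z_m are i.i.d. N(0, σ²). -/
theorem thresholded_sum_stochastically_maximized_m
    (m : ℕ) (hm : 0 < m) (θ : Fin m → ℝ) (σ2 : ℝ≥0) (hσ : 0 < σ2)
    (lam : ℝ) (hlam : 0 ≤ lam) (ξ : ℝ) (hξ : ξ = ∑ i, (θ i) ^ 2) (x : ℝ) :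
    (Measure.pi fun i : Fin m => gaussianReal (θ i) σ2)
        {y : Fin m → ℝ | x ≤ ∑ i, max ((y i) ^ 2 - lam) 0}
      ≤ (Measure.pi fun _ : Fin m => gaussianReal 0 σ2)
        {y : Fin m → ℝ |
          x ≤ ∑ i, max ((y i + if i = ⟨0, hm⟩ then Real.sqrt ξ else 0) ^ 2 - lam) 0} := by
  obtain ⟨n, rfl⟩ := Nat.exists_eq_succ_of_ne_zero hm.ne'
  subst hξ
  refine (pi_gaussianReal_threshold_le hσ.ne' lam θ x).trans_eq ?_
  have hmap := Measure.pi_map_pi (μ := fun _ : Fin (n + 1) => gaussianReal 0 σ2)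
    (f := fun i y => y + if i = 0 then √(∑ i, θ i ^ 2) else 0) (fun i => by fun_prop)
  simp only [gaussianReal_map_add_const, zero_add] at hmap
  rw [← hmap, Measure.map_apply (by fun_prop) (measurableSet_le measurable_const (by fun_prop))]
  rfl
end

section
/- Let X_m be a chi-square random variable with m ≥ 2 degrees of freedom. Then P(X_m ≥ m + 2√(m log m)) ≤ 3/m. -/
open MeasureTheory ProbabilityTheory
open scoped NNReal ENNReal

/-- The exponential moment of the square of a standard normal variable, parametrised so that the
value is `√a`. -/
lemma integral_exp_mul_sq_gaussianReal {a : ℝ} (ha : 0 < a) :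
    ∫ x, Real.exp ((1 - a⁻¹) / 2 * x ^ 2) ∂(gaussianReal 0 1) = √a := by
  rw [integral_gaussianReal_eq_integral_smul one_ne_zero]
  have h (x : ℝ) : gaussianPDFReal 0 1 x • Real.exp ((1 - a⁻¹) / 2 * x ^ 2)
      = (√(2 * Real.pi))⁻¹ * Real.exp (-(2 * a)⁻¹ * x ^ 2) := by
    simp only [gaussianPDFReal, smul_eq_mul, mul_assoc, ← Real.exp_add, NNReal.coe_one, mul_one]
    congr 2
    field_simp
    ring
  simp_rw [h]
  rw [integral_const_mul, integral_gaussian, div_inv_eq_mul,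
    show Real.pi * (2 * a) = 2 * Real.pi * a by ring,
    Real.sqrt_mul (show 0 ≤ 2 * Real.pi by positivity),
    inv_mul_cancel_left₀ (by positivity)]

/-- The Chernoff bound for the upper tail of a sum of squares of independent standard normals. -/
lemma measureReal_pi_gaussianReal_sum_sq_ge_le (m : ℕ) {ε : ℝ} (hε : 0 ≤ ε) :
    (Measure.pi fun _ : Fin m => gaussianReal 0 1).real {y | m * (1 + ε) ≤ ∑ i, y i ^ 2}
      ≤ Real.exp (-(m / 2 * (ε - Real.log (1 + ε)))) := by
  have ha : 0 < 1 + ε := by positivity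
  set t : ℝ := (1 - (1 + ε)⁻¹) / 2 with ht_def
  have ht : 0 ≤ t := by
    have : (1 + ε)⁻¹ ≤ 1 := inv_le_one_of_one_le₀ (by linarith)
    linarith
  have hexp (y : Fin m → ℝ) :
      Real.exp (t * ∑ i, y i ^ 2) = ∏ i, Real.exp (t * y i ^ 2) := by
    rw [Finset.mul_sum, Real.exp_sum]
  have hint : ∫ y, Real.exp (t * ∑ i, y i ^ 2)
      ∂(Measure.pi fun _ : Fin m => gaussianReal 0 1) = √(1 + ε) ^ m := by
    simp_rw [hexp]
    rw [integral_fintype_prod_eq_pow (fun x : ℝ => Real.exp (t * x ^ 2)),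
      integral_exp_mul_sq_gaussianReal ha, Fintype.card_fin]
  have hne : √(1 + ε) ^ m ≠ 0 := by positivity
  refine (measure_ge_le_exp_mul_mgf (t := t) (m * (1 + ε)) ht
    (Integrable.of_integral_ne_zero (hint ▸ hne))).trans_eq ?_
  rw [mgf, hint, ← Real.exp_log (show 0 < √(1 + ε) ^ m by positivity), ← Real.exp_add,
    Real.log_pow, Real.log_sqrt ha.le, ht_def]
  congr 1
  field_simp
  ring

/-- A Padé upper bound for the logarithm. -/
lemma log_one_add_le_pade {x : ℝ} (hx : 0 ≤ x) :
    Real.log (1 + x) ≤ x * (6 + x) / (6 + 4 * x) := by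
  let f : ℝ → ℝ := fun x => x * (6 + x) / (6 + 4 * x) - Real.log (1 + x)
  have hd (y : ℝ) (hy : 0 ≤ y) :
      HasDerivAt f (4 * y ^ 3 / ((6 + 4 * y) ^ 2 * (1 + y))) y := by
    have h1 : HasDerivAt (fun y : ℝ => y * (6 + y)) (1 * (6 + y) + y * 1) y :=
      (hasDerivAt_id y).mul ((hasDerivAt_id y).const_add 6)
    have h2 : HasDerivAt (fun y : ℝ => 6 + 4 * y) (4 * 1) y :=
      ((hasDerivAt_id y).const_mul 4).const_add 6
    have h3 : HasDerivAt (fun y : ℝ => Real.log (1 + y)) (1 / (1 + y)) y :=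
      ((hasDerivAt_id y).const_add 1).log (by simp only [id]; positivity)
    refine ((h1.div h2 (by positivity)).sub h3).congr_deriv ?_
    field_simp
    ring
  have hmono : MonotoneOn f (Set.Ici 0) := by
    refine monotoneOn_of_deriv_nonneg (convex_Ici 0)
      (fun y hy => (hd y hy).continuousAt.continuousWithinAt) ?_ ?_
    · intro y hy
      rw [interior_Ici] at hy
      exact (hd y (le_of_lt hy)).differentiableAt.differentiableWithinAt
    · intro y hy
      rw [interior_Ici] at hy
      have hy' : 0 < y := hy
      rw [(hd y hy'.le).deriv]
      positivity
  have h := hmono (Set.mem_Ici.2 le_rfl) (Set.mem_Ici.2 hx) hx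
  simp only [f] at h
  norm_num at h
  exact h

lemma cubic_le_exp_half_sq {s : ℝ} (hs : 0 ≤ s) :
    4 / 3 * s ^ 3 ≤ (10986 / 10000) * (Real.exp (s ^ 2 / 2) + 4 / 3 * s) := by
  obtain ⟨v, hv⟩ : ∃ v, s ^ 2 = 2 * (2 + v) := ⟨s ^ 2 / 2 - 2, by ring⟩
  have hv2 : -2 ≤ v := by nlinarith [sq_nonneg s]
  have he2 : (7389 / 1000 : ℝ) ≤ Real.exp 2 := by
    rw [show (2 : ℝ) = 1 + 1 by norm_num, Real.exp_add]
    nlinarith [Real.exp_one_gt_d9]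
  have hexp : Real.exp (s ^ 2 / 2) = Real.exp 2 * Real.exp v := by
    rw [← Real.exp_add, hv]; congr 1; ring
  have hs_le : s ≤ (s ^ 2 / (19 / 10) + 19 / 10) / 2 := by nlinarith [sq_nonneg (s - 19 / 10)]
  have hpoly : (4 / 3 * s ^ 2 - (10986 / 10000) * (4 / 3)) * ((s ^ 2 / (19 / 10) + 19 / 10) / 2)
      ≤ (10986 / 10000) * ((7389 / 1000) * Real.exp v) := by
    rw [hv]
    rcases le_total 0 v with h0 | h0
    · nlinarith [Real.quadratic_le_exp_of_nonneg h0, sq_nonneg v]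
    · have h4 : (1 + v / 4) ^ 4 ≤ Real.exp v := by
        have := Real.one_sub_div_pow_le_exp_neg (n := 4) (t := -v) (by norm_num; linarith)
        norm_num at this
        convert this using 2
        ring
      nlinarith [h4, sq_nonneg (v + 59 / 100), sq_nonneg (v ^ 2),
        mul_nonneg (sq_nonneg v) (sub_nonneg.2 hv2)]
  have hE : (7389 / 1000) * Real.exp v ≤ Real.exp (s ^ 2 / 2) := by
    rw [hexp]; gcongr
  have hE0 := Real.exp_pos (s ^ 2 / 2)
  rcases le_total (4 / 3 * s ^ 2 - (10986 / 10000) * (4 / 3)) 0 with h | h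
  · nlinarith [mul_nonneg hs (neg_nonneg.2 h)]
  · nlinarith [mul_le_mul_of_nonneg_left hs_le h]

/-- Let X_m be a chi-square random variable with m ≥ 2 degrees of freedom
(the sum of m squares of i.i.d. standard normals). Then
P(X_m ≥ m + 2√(m log m)) ≤ 3/m. -/
theorem chisq_tail_bound (m : ℕ) (hm : 2 ≤ m) :
    (Measure.pi fun _ : Fin m => gaussianReal 0 1)
        {y : Fin m → ℝ |
          (m : ℝ) + 2 * Real.sqrt (m * Real.log m) ≤ ∑ i, (y i) ^ 2}
      ≤ ENNReal.ofReal (3 / m) := by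
  have hm0 : (0 : ℝ) < m := by positivity
  have hlog : 0 ≤ Real.log m := Real.log_natCast_nonneg m
  obtain ⟨s, hs_def⟩ : ∃ s, s = √(Real.log m) := ⟨_, rfl⟩
  obtain ⟨w, hw_def⟩ : ∃ w, w = √(m : ℝ) := ⟨_, rfl⟩
  have hs : 0 ≤ s := hs_def ▸ Real.sqrt_nonneg _
  have hw : 0 < w := hw_def ▸ Real.sqrt_pos.2 hm0
  have hs2 : s ^ 2 = Real.log m := by rw [hs_def, Real.sq_sqrt hlog]
  have hw2 : (m : ℝ) = w ^ 2 := by rw [hw_def, Real.sq_sqrt hm0.le]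
  have hwexp : Real.exp (s ^ 2 / 2) = w := by
    rw [hs2, ← Real.log_sqrt hm0.le, ← hw_def, Real.exp_log hw]
  have hset : (m : ℝ) + 2 * √(m * Real.log m) = m * (1 + 2 * s / w) := by
    rw [Real.sqrt_mul hm0.le, ← hs_def, ← hw_def, hw2]
    field_simp
  have hε : 0 ≤ 2 * s / w := by positivity
  have hcubic := cubic_le_exp_half_sq hs
  rw [hwexp] at hcubic
  rw [hset, ENNReal.le_ofReal_iff_toReal_le (measure_ne_top _ _) (by positivity)]
  refine (measureReal_pi_gaussianReal_sum_sq_ge_le m hε).trans ?_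
  rw [← Real.exp_log (show (0 : ℝ) < 3 / m by positivity),
    Real.log_div (by norm_num) hm0.ne', Real.exp_le_exp, ← hs2, hw2]
  have hpade := log_one_add_le_pade hε
  have hrate : s ^ 2 - (10986 / 10000) ≤ w ^ 2 / 2 *
      (2 * s / w - 2 * s / w * (6 + 2 * s / w) / (6 + 4 * (2 * s / w))) := by
    have : w ^ 2 / 2 * (2 * s / w - 2 * s / w * (6 + 2 * s / w) / (6 + 4 * (2 * s / w)))
        = s ^ 2 * w / (w + 4 / 3 * s) := by
      field_simp
      ring
    rw [this, le_div_iff₀ (by positivity)]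
    linarith
  have hle := mul_le_mul_of_nonneg_left (sub_le_sub_left hpade (2 * s / w))
    (show 0 ≤ w ^ 2 / 2 by positivity)
  linarith [Real.log_three_gt_d9]
end
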